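/- For all real p with 0 < p ≤ 1/5 and all x with p ≤ x < 1, the function g(x) = log((1−x)/(1−p))·(−log(x/p) + x − 1) − x·log(x/p) satisfies g(x) ≥ 0. -/

import Mathlib

open Real

theorem hasDerivAt_log_mul_sub_mul_log {p y : ℝ} (hp : 0 < p) (hp1 : p < 1) (hy0 : 0 < y)
    (hy1 : y < 1) :
    HasDerivAt (fun x : ℝ => log ((1 - x) / (1 - p)) * (-log (x / p) + x - 1) - x * log (x / p))
      ((y ^ 2 * log (y / p) - (1 - y) ^ 2 * log ((1 - y) / (1 - p))) / (y * (1 - y))) y := by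
  have h1 : 0 < 1 - y := sub_pos.2 hy1
  have h2 : 0 < 1 - p := sub_pos.2 hp1
  have hA : HasDerivAt (fun x : ℝ => log (x / p)) (1 / p / (y / p)) y :=
    ((hasDerivAt_id y).div_const p).log (div_pos hy0 hp).ne'
  have hB : HasDerivAt (fun x : ℝ => log ((1 - x) / (1 - p)))
      (-1 / (1 - p) / ((1 - y) / (1 - p))) y :=
    (((hasDerivAt_id y).const_sub 1).div_const (1 - p)).log (div_pos h1 h2).ne'
  refine ((hB.mul ((hA.neg.add (hasDerivAt_id y)).sub_const 1)).sub
    ((hasDerivAt_id y).mul hA)).congr_deriv ?_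
  simp only [Pi.add_apply, Pi.neg_apply, id]
  generalize log (y / p) = A
  generalize log ((1 - y) / (1 - p)) = B
  field_simp
  ring

/-- For 0 < p ≤ 1/5 and p ≤ x < 1,
    g(x) = log((1−x)/(1−p))·(−log(x/p) + x − 1) − x·log(x/p) ≥ 0. -/
theorem g_nonneg (p x : ℝ) (hp0 : 0 < p) (hp : p ≤ 1/5)
    (hx1 : p ≤ x) (hx2 : x < 1) :
    0 ≤ Real.log ((1 - x) / (1 - p)) * (-Real.log (x / p) + x - 1)
        - x * Real.log (x / p) := by
  have hp1 : p < 1 := by linarith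
  have hderiv : ∀ y ∈ Set.Ico p 1, HasDerivAt _ _ y := fun y hy =>
    hasDerivAt_log_mul_sub_mul_log hp0 hp1 (hp0.trans_le hy.1) hy.2
  have hmono := monotoneOn_of_hasDerivWithinAt_nonneg (convex_Ico p 1)
    (fun y hy => (hderiv y hy).continuousAt.continuousWithinAt)
    (fun y hy => (hderiv y (interior_subset hy)).hasDerivWithinAt) (fun y hy => by
      obtain ⟨hy0, hy1⟩ := interior_subset hy
      have hA : 0 ≤ log (y / p) := log_nonneg ((one_le_div hp0).2 hy0)
      have hB : log ((1 - y) / (1 - p)) ≤ 0 :=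
        log_nonpos (div_nonneg (by linarith) (by linarith))
          ((div_le_one (by linarith)).2 (by linarith))
      refine div_nonneg (sub_nonneg.2 ?_) (mul_nonneg (hp0.le.trans hy0) (by linarith))
      exact (mul_nonpos_of_nonneg_of_nonpos (sq_nonneg _) hB).trans
        (mul_nonneg (sq_nonneg _) hA))
  have h := hmono (Set.left_mem_Ico.2 hp1) ⟨hx1, hx2⟩ hx1
  simpa [div_self hp0.ne', div_self (sub_pos.2 hp1).ne'] using h
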